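/- For every connected simple graph G with maximum degree Δ(G) ≥ 6, the energy of G satisfies E(G) ≤ 2·ν(G)·√Δ(G), where E(G) is the graph energy and ν(G) is the matching number of G. -/

import Mathlib

open SimpleGraph Matrix

/-- The adjacency matrix of a simple graph over `ℝ` is Hermitian. -/
theorem adjMatrix_isHermitian {V : Type*} [Fintype V] [DecidableEq V]
    (G : SimpleGraph V) [DecidableRel G.Adj] : (G.adjMatrix ℝ).IsHermitian := by
  rw [Matrix.IsHermitian, Matrix.conjTranspose_eq_transpose_of_trivial]
  exact G.isSymm_adjMatrix

/-- The energy of a graph: the sum of the absolute values of the eigenvalues of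
its adjacency matrix. -/
noncomputable def graphEnergy {V : Type*} [Fintype V] [DecidableEq V]
    (G : SimpleGraph V) : ℝ :=
  letI : DecidableRel G.Adj := Classical.decRel _
  ∑ i, |(adjMatrix_isHermitian G).eigenvalues i|

/-- The matching number of a graph: the maximum number of edges in a matching. -/
noncomputable def matchingNumber {V : Type*} [Fintype V] (G : SimpleGraph V) : ℕ :=
  sSup {k | ∃ M : G.Subgraph, M.IsMatching ∧ M.edgeSet.ncard = k}

/-- The maximum vertex degree of a graph. -/
noncomputable def maxDeg {V : Type*} [Fintype V] (G : SimpleGraph V) : ℕ :=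
  letI : DecidableRel G.Adj := Classical.decRel _
  G.maxDegree

/-- An involution of the vertices, encoding the matching of `G` inside `W` whose edges are the
pairs `{v, f v}` with `f v ≠ v`. -/
def IsMatchingInvolution {V : Type*} (G : SimpleGraph V) (W : Finset V) (f : V → V) : Prop :=
  (∀ v, f (f v) = v) ∧ ∀ v, f v ≠ v → v ∈ W ∧ G.Adj v (f v)

/-- The vertices moved by `f`. -/
def coveredVertices {V : Type*} [Fintype V] [DecidableEq V] (f : V → V) : Finset V :=
  {v | f v ≠ v}

/-- A matching of `G` inside `W` covering as many vertices as possible. -/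
def IsMaximumMatchingInvolution {V : Type*} [Fintype V] [DecidableEq V]
    (G : SimpleGraph V) (W : Finset V) (f : V → V) : Prop :=
  IsMatchingInvolution G W f ∧
    ∀ g, IsMatchingInvolution G W g → (coveredVertices g).card ≤ (coveredVertices f).card

theorem Finset.even_card_of_involution {V : Type*} {f : V → V} (s : Finset V)
    (hf : ∀ v, f (f v) = v) (hs : ∀ v ∈ s, f v ∈ s) (hne : ∀ v ∈ s, f v ≠ v) : Even s.card := by
  have h : ∑ v ∈ s, (1 : ZMod 2) = 0 :=
    Finset.sum_involution (fun v _ ↦ f v) (fun _ _ ↦ by decide) (fun v hv _ ↦ hne v hv)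
      (fun v hv ↦ hs v hv) (fun v _ ↦ hf v)
  rw [Finset.sum_const, nsmul_eq_mul, mul_one] at h
  exact (ZMod.natCast_eq_zero_iff_even).1 h

section Matching

variable {V : Type*} [Fintype V] [DecidableEq V] {G : SimpleGraph V} {W : Finset V} {f g : V → V}

theorem mem_coveredVertices {v : V} : v ∈ coveredVertices f ↔ f v ≠ v := by
  simp [coveredVertices]

theorem IsMatchingInvolution.even_card (hf : IsMatchingInvolution G W f) :
    Even (coveredVertices f).card := by
  refine Finset.even_card_of_involution _ hf.1 (fun v hv ↦ ?_) fun v hv ↦ ?_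
  · rw [mem_coveredVertices] at *
    grind [hf.1 v]
  · exact mem_coveredVertices.1 hv

variable (G W) in
theorem exists_isMaximumMatchingInvolution : ∃ f, IsMaximumMatchingInvolution G W f := by
  classical
  obtain ⟨f, hf, hmax⟩ := (Finset.univ.filter (IsMatchingInvolution G W)).exists_max_image
    (fun f ↦ (coveredVertices f).card) ⟨id, by simp [IsMatchingInvolution]⟩
  exact ⟨f, by simpa using hf, fun g hg ↦ hmax g (by simpa using hg)⟩

theorem IsMaximumMatchingInvolution.of_card_le (hf : IsMaximumMatchingInvolution G W f)
    (hg : IsMatchingInvolution G W g) (h : (coveredVertices f).card ≤ (coveredVertices g).card) :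
    IsMaximumMatchingInvolution G W g :=
  ⟨hg, fun k hk ↦ (hf.2 k hk).trans h⟩

theorem IsMaximumMatchingInvolution.not_adj (hf : IsMaximumMatchingInvolution G W f) {x y : V}
    (hx : x ∈ W) (hy : y ∈ W) (hfx : f x = x) (hfy : f y = y) : ¬ G.Adj x y := by
  intro hadj
  have hne := hadj.ne
  obtain ⟨⟨hinv, hedge⟩, hmax⟩ := hf
  let g : V → V := fun v ↦ if v = x then y else if v = y then x else f v
  have hg : IsMatchingInvolution G W g := by
    refine ⟨fun v ↦ ?_, fun v hv ↦ ?_⟩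
    · have := hinv v
      grind
    · have := hedge v
      have := hadj.symm
      grind
  have hlt : coveredVertices f ⊂ coveredVertices g := by
    refine (Finset.ssubset_iff_of_subset fun v hv ↦ ?_).2 ⟨x, ?_, ?_⟩ <;>
      grind [mem_coveredVertices]
  exact (Finset.card_lt_card hlt).not_ge (hmax g hg)

/-- A step of the proof of Gallai's lemma: the edge of `f` at `x` is exchanged for the edge of `g`
at `f x`. -/
theorem IsMaximumMatchingInvolution.exists_exchange (hf : IsMatchingInvolution G W f)
    (hg : IsMaximumMatchingInvolution G W g) {x t : V} (hfx : f x ≠ x) (hgx : g x = x)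
    (hgt : g t = t) (hxt : x ≠ t) :
    ∃ h, IsMaximumMatchingInvolution G W h ∧ h t = t ∧
      ({v | f v ≠ v ∧ g v = f v} : Finset V) ⊂ ({v | f v ≠ v ∧ h v = f v} : Finset V) := by
  obtain ⟨hinv, hedge⟩ := hf
  have hxW := hedge x hfx
  have hffx := hinv x
  have hyW := hedge (f x) (by grind)
  have hgy : g (f x) ≠ f x := fun h ↦ hg.not_adj hxW.1 hyW.1 hgx h hxW.2
  have ginv := hg.1.1
  let h : V → V := fun v ↦
    if v = x then f x else if v = f x then x else if v = g (f x) then v else g v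
  have hh : IsMatchingInvolution G W h := by
    refine ⟨fun v ↦ ?_, fun v hv ↦ ?_⟩
    · have := ginv v
      have := ginv (f x)
      grind
    · have := hg.1.2 v
      grind
  have hcov : coveredVertices h = insert x ((coveredVertices g).erase (g (f x))) := by
    ext v
    have := ginv v
    have := ginv (f x)
    grind [mem_coveredVertices]
  refine ⟨h, hg.of_card_le hh ?_, ?_, ?_⟩
  · have := ginv (f x)
    rw [hcov, Finset.card_insert_of_notMem (by grind [mem_coveredVertices]),
      Finset.card_erase_of_mem (by grind [mem_coveredVertices])]
    omega
  · grind
  · refine (Finset.ssubset_iff_of_subset fun v hv ↦ ?_).2 ⟨x, ?_, ?_⟩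
    · have := ginv (f x)
      have := hinv v
      grind
    · grind
    · grind

/-- Gallai's lemma: if `t` is missed by some maximum matching, and some maximum matching misses
both `u` and `v`, then some maximum matching misses `t` together with `u` or `v`. -/
theorem exists_isMaximumMatchingInvolution_missing_pair {u v t : V} (huv : u ≠ v)
    (hf : IsMaximumMatchingInvolution G W f) (hfu : f u = u) (hfv : f v = v)
    (hg : IsMaximumMatchingInvolution G W g) (hgt : g t = t) :
    ∃ h, IsMaximumMatchingInvolution G W h ∧ h t = t ∧ (h u = u ∨ h v = v) := by
  classical
  by_contra! hno
  obtain ⟨h, hh, hmax⟩ := (Finset.univ.filter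
      fun h ↦ IsMaximumMatchingInvolution G W h ∧ h t = t).exists_max_image
    (fun h ↦ ({v | f v ≠ v ∧ h v = f v} : Finset V).card) ⟨g, by simp [hg, hgt]⟩
  simp only [Finset.mem_filter, Finset.mem_univ, true_and] at hh hmax
  obtain ⟨hh, hht⟩ := hh
  have hcard : (((coveredVertices h).erase u).erase v).card <
      ((coveredVertices f).erase t).card := by
    have h1 : (coveredVertices f).card = (coveredVertices h).card :=
      le_antisymm (hh.2 f hf.1) (hf.2 h hh.1)
    have h2 := hno h hh hht
    rw [Finset.card_erase_of_mem (s := (coveredVertices h).erase u)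
        (by simp [mem_coveredVertices, h2.2, huv.symm]),
      Finset.card_erase_of_mem (s := coveredVertices h) (mem_coveredVertices.2 h2.1)]
    have h3 := Finset.pred_card_le_card_erase (s := coveredVertices f) (a := t)
    have h4 : 1 < (coveredVertices h).card :=
      Finset.one_lt_card.2 ⟨u, by simp [mem_coveredVertices, h2.1], v,
        by simp [mem_coveredVertices, h2.2], huv⟩
    omega
  obtain ⟨x, hx, hx'⟩ := Finset.exists_mem_notMem_of_card_lt_card hcard
  simp only [Finset.mem_erase, mem_coveredVertices] at hx hx'
  obtain ⟨k, hk, hkt, hlt⟩ := IsMaximumMatchingInvolution.exists_exchange (x := x) (t := t)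
    hf.1 hh hx.2 (by grind) hht hx.1
  exact (Finset.card_lt_card hlt).not_ge (hmax k ⟨hk, hkt⟩)

/-- If every vertex is missed by some maximum matching, the vertices are partitioned into classes
without edges between them, each of which has at most one vertex missed by a given maximum
matching. -/
theorem exists_labelling_of_forall_exists_missing
    (hall : ∀ v, ∃ g, IsMaximumMatchingInvolution G W g ∧ g v = v) :
    ∃ c : V → V, (∀ u ∈ W, ∀ v ∈ W, G.Adj u v → c u = c v) ∧
      ∀ g, IsMaximumMatchingInvolution G W g → ∀ u v, g u = u → g v = v → c u = c v → u = v := by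
  let r : Setoid V :=
    { r := fun u v ↦ u = v ∨ ∀ g, IsMaximumMatchingInvolution G W g → ¬ (g u = u ∧ g v = v)
      iseqv :=
        { refl := fun u ↦ Or.inl rfl
          symm := fun h ↦ by grind
          trans := fun {u t v} h₁ h₂ ↦ by
            by_cases huv : u = v
            · exact Or.inl huv
            refine Or.inr fun f hf ⟨hfu, hfv⟩ ↦ ?_
            obtain ⟨g, hg, hgt⟩ := hall t
            obtain ⟨h, hh, hht, hhuv⟩ :=
              exists_isMaximumMatchingInvolution_missing_pair huv hf hfu hfv hg hgt
            grind } }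
  have hr : ∀ u v, (Quotient.mk r u).out = (Quotient.mk r v).out ↔
      (u = v ∨ ∀ g, IsMaximumMatchingInvolution G W g → ¬ (g u = u ∧ g v = v)) := fun u v ↦ by
    rw [Quotient.out_inj, Quotient.eq]
    rfl
  refine ⟨fun v ↦ (Quotient.mk r v).out, fun u hu v hv huv ↦ ?_, fun g hg u v hu hv huv ↦ ?_⟩
  · exact (hr u v).2 (Or.inr fun g hg h ↦ hg.not_adj hu hv h.1 h.2 huv)
  · rcases (hr u v).1 huv with h | h
    · exact h
    · exact (h g hg ⟨hu, hv⟩).elim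

/-- A form of the nontrivial direction of the Tutte–Berge formula. -/
theorem exists_barrier (G : SimpleGraph V) (W : Finset V) :
    ∃ f, IsMatchingInvolution G W f ∧ ∃ A ⊆ W, ∃ c : V → V,
      (∀ u ∈ W \ A, ∀ v ∈ W \ A, G.Adj u v → c u = c v) ∧
      2 * A.card + ∑ l, 2 * (({w ∈ W \ A | c w = l} : Finset V).card / 2) ≤
        (coveredVertices f).card := by
  induction hn : W.card generalizing W with
  | zero =>
    obtain rfl := Finset.card_eq_zero.1 hn
    exact ⟨id, ⟨by simp, by simp⟩, ∅, by simp, id, by simp, by simp⟩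
  | succ n ih =>
    obtain ⟨f, hf⟩ := exists_isMaximumMatchingInvolution G W
    by_cases hall : ∀ v ∈ W, ∃ g, IsMaximumMatchingInvolution G W g ∧ g v = v
    · obtain ⟨c, hadj, hc⟩ := exists_labelling_of_forall_exists_missing (G := G) (W := W)
        fun v ↦ by
          by_cases hv : v ∈ W
          · exact hall v hv
          · exact ⟨f, hf, by_contra fun h ↦ hv (hf.1.2 v h).1⟩
      refine ⟨f, hf.1, ∅, by simp, c, by simpa using hadj, ?_⟩
      have hcov : (coveredVertices f).card =
          ∑ l, ({w ∈ coveredVertices f | c w = l} : Finset V).card :=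
        Finset.card_eq_sum_card_fiberwise (by simp)
      rw [hcov, Finset.card_empty, mul_zero, zero_add]
      refine Finset.sum_le_sum fun l _ ↦ ?_
      rw [Finset.sdiff_empty]
      have heven : Even ({w ∈ coveredVertices f | c w = l} : Finset V).card := by
        refine Finset.even_card_of_involution _ hf.1.1 (fun v hv ↦ ?_) fun v hv ↦ ?_
        · simp only [Finset.mem_filter, mem_coveredVertices] at hv ⊢
          have h1 := hf.1.1 v
          have h2 := hf.1.2 v hv.1
          have h3 := hf.1.2 (f v) (by grind)
          exact ⟨by grind, (hadj _ h2.1 _ h3.1 h2.2).symm.trans hv.2⟩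
        · exact mem_coveredVertices.1 (Finset.mem_filter.1 hv).1
      have hsub : ({w ∈ W | c w = l} : Finset V) \ {w ∈ coveredVertices f | c w = l} ⊆
          ({w | f w = w ∧ c w = l} : Finset V) := by
        intro v
        grind [mem_coveredVertices]
      have hone : ({w | f w = w ∧ c w = l} : Finset V).card ≤ 1 := by
        refine Finset.card_le_one.2 fun u hu v hv ↦ ?_
        simp only [Finset.mem_filter, Finset.mem_univ, true_and] at hu hv
        exact hc f hf u v hu.1 hv.1 (hu.2.trans hv.2.symm)
      have h1 := Finset.card_le_card hsub
      have h2 := Finset.le_card_sdiff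
        ({w ∈ coveredVertices f | c w = l} : Finset V) {w ∈ W | c w = l}
      obtain ⟨k, hk⟩ := heven
      omega
    · push Not at hall
      obtain ⟨v, hv, hcovered⟩ := hall
      obtain ⟨g, hg, A, hA, c, hadj, hle⟩ := ih (W.erase v) (by
        rw [Finset.card_erase_of_mem hv, hn, Nat.add_sub_cancel])
      have hvA : v ∉ A := fun h ↦ by simpa using hA h
      have hW : W \ insert v A = W.erase v \ A := by grind
      refine ⟨f, hf.1, insert v A, by grind, c, by rwa [hW], ?_⟩
      rw [hW, Finset.card_insert_of_notMem hvA]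
      have hgW : IsMatchingInvolution G W g :=
        ⟨hg.1, fun w hw ↦ ⟨Finset.mem_of_mem_erase (hg.2 w hw).1, (hg.2 w hw).2⟩⟩
      have hgv : g v = v := by_contra fun h ↦ by simpa using (hg.2 v h).1
      have hlt : (coveredVertices g).card < (coveredVertices f).card := by
        by_contra! h
        exact hcovered g (hf.of_card_le hgW h) hgv
      obtain ⟨k, hk⟩ := hg.even_card
      obtain ⟨l, hl⟩ := hf.1.even_card
      omega

theorem IsMatchingInvolution.card_le_two_mul_matchingNumber (hf : IsMatchingInvolution G W f) :
    (coveredVertices f).card ≤ 2 * matchingNumber G := by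
  obtain ⟨hinv, hedge⟩ := hf
  let M : G.Subgraph :=
    { verts := {v | f v ≠ v}
      Adj := fun u v ↦ f u = v ∧ u ≠ v
      adj_sub := by
        rintro u v ⟨rfl, h⟩
        exact (hedge u h.symm).2
      edge_vert := by
        rintro u v ⟨rfl, h⟩
        exact h.symm
      symm := ⟨by
        rintro u v ⟨rfl, h⟩
        exact ⟨hinv u, h.symm⟩⟩ }
  have hM : M.IsMatching := fun v hv ↦ ⟨f v, ⟨rfl, Ne.symm hv⟩, fun w hw ↦ hw.1.symm⟩
  have hbdd : BddAbove {k | ∃ M : G.Subgraph, M.IsMatching ∧ M.edgeSet.ncard = k} := by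
    refine ⟨(Set.univ : Set (Sym2 V)).ncard, ?_⟩
    rintro _ ⟨M, -, rfl⟩
    exact Set.ncard_le_ncard (Set.subset_univ _)
  have hle : M.edgeSet.ncard ≤ matchingNumber G := le_csSup hbdd ⟨M, hM, rfl⟩
  have himage : ((coveredVertices f).image fun v ↦ s(v, f v)).card ≤ M.edgeSet.ncard := by
    rw [← Set.ncard_coe_finset]
    refine Set.ncard_le_ncard fun e he ↦ ?_
    obtain ⟨v, hv, rfl⟩ := Finset.mem_image.1 (Finset.mem_coe.1 he)
    exact ⟨rfl, (mem_coveredVertices.1 hv).symm⟩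
  refine (Finset.card_le_mul_card_image (f := fun v ↦ s(v, f v)) _ 2 fun e he ↦ ?_).trans
    (Nat.mul_le_mul_left 2 (himage.trans hle))
  obtain ⟨u, -, rfl⟩ := Finset.mem_image.1 he
  refine (Finset.card_le_card (t := {u, f u}) fun v hv ↦ ?_).trans Finset.card_le_two
  have := (Finset.mem_filter.1 hv).2
  simp only [Sym2.eq_iff] at this
  grind

end Matching

section SignMatrix

variable {V : Type*} [Fintype V] [DecidableEq V]

/-- A Hermitian matrix has a symmetric orthogonal sign matrix `S`, for which `tr (S A)` is the sum
of the absolute values of the eigenvalues of `A`. -/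
theorem Matrix.IsHermitian.exists_sign {A : Matrix V V ℝ} (hA : A.IsHermitian) :
    ∃ S : Matrix V V ℝ, S.IsSymm ∧ S * S = 1 ∧ ∑ i, |hA.eigenvalues i| = (S * A).trace := by
  set U : Matrix V V ℝ := (hA.eigenvectorUnitary : Matrix V V ℝ)
  have hUU : star U * U = 1 := Unitary.coe_star_mul_self _
  have hUU' : U * star U = 1 := Unitary.coe_mul_star_self _
  have hspec : A = U * diagonal hA.eigenvalues * star U := by
    have h := hA.spectral_theorem
    rw [Unitary.conjStarAlgAut_apply] at h
    exact h
  let σ : V → ℝ := fun i ↦ if 0 ≤ hA.eigenvalues i then 1 else -1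
  have hσ : diagonal σ * diagonal σ = (1 : Matrix V V ℝ) := by
    rw [diagonal_mul_diagonal, ← diagonal_one]
    congr 1
    ext i
    by_cases h : 0 ≤ hA.eigenvalues i <;> simp [σ, h]
  refine ⟨U * diagonal σ * star U, ?_, ?_, ?_⟩
  · simp [Matrix.IsSymm, Matrix.star_eq_conjTranspose,
      Matrix.conjTranspose_eq_transpose_of_trivial, Matrix.transpose_mul, mul_assoc]
  · calc U * diagonal σ * star U * (U * diagonal σ * star U)
        = U * (diagonal σ * (star U * U) * diagonal σ) * star U := by simp only [mul_assoc]
      _ = 1 := by rw [hUU, mul_one, hσ, mul_one, hUU']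
  · have h : U * diagonal σ * star U * A =
        U * (diagonal σ * diagonal hA.eigenvalues * star U) := by
      calc U * diagonal σ * star U * A
          = U * diagonal σ * (star U * U) * diagonal hA.eigenvalues * star U := by
            conv_lhs => rw [hspec]
            simp only [mul_assoc]
        _ = _ := by rw [hUU, mul_one]; simp only [mul_assoc]
    rw [h, Matrix.trace_mul_comm, mul_assoc, hUU, mul_one, diagonal_mul_diagonal, trace_diagonal]
    refine Finset.sum_congr rfl fun i _ ↦ ?_
    by_cases h : 0 ≤ hA.eigenvalues i
    · simp [σ, h, abs_of_nonneg]
    · simp [σ, h, abs_of_neg (not_le.1 h)]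

variable {S : Matrix V V ℝ}

theorem Matrix.IsSymm.sum_sq_row_eq_one (hS : S.IsSymm) (hSS : S * S = 1) (i : V) :
    ∑ j, S i j ^ 2 = 1 := by
  have h := congrFun (congrFun hSS i) i
  rw [Matrix.mul_apply, Matrix.one_apply_eq] at h
  rw [← h]
  exact Finset.sum_congr rfl fun j _ ↦ by rw [hS.apply i j, sq]

theorem Matrix.IsSymm.sum_sum_le_card (hS : S.IsSymm) (hSS : S * S = 1) (H : Finset V) :
    ∑ i ∈ H, ∑ j ∈ H, S i j ≤ H.card := by
  let x : V → ℝ := fun i ↦ if i ∈ H then 1 else 0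
  have hx : ∀ i, (S *ᵥ x) i = ∑ j ∈ H, S i j := fun i ↦ by simp [Matrix.mulVec, dotProduct, x]
  have hsq : ∑ i, (S *ᵥ x) i ^ 2 = H.card := by
    have h : (S *ᵥ x) ⬝ᵥ (S *ᵥ x) = x ⬝ᵥ x := by
      rw [Matrix.dotProduct_mulVec, Matrix.vecMul_mulVec, hS.eq, hSS, Matrix.vecMul_one]
    calc ∑ i, (S *ᵥ x) i ^ 2 = (S *ᵥ x) ⬝ᵥ (S *ᵥ x) := by simp [dotProduct, sq]
      _ = H.card := by rw [h]; simp [dotProduct, x]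
  have hle : ∑ i ∈ H, (S *ᵥ x) i ^ 2 ≤ H.card := by
    rw [← hsq]
    exact Finset.sum_le_sum_of_subset_of_nonneg (Finset.subset_univ _) fun _ _ _ ↦ sq_nonneg _
  calc ∑ i ∈ H, ∑ j ∈ H, S i j = ∑ i ∈ H, (S *ᵥ x) i := by simp only [hx]
    _ ≤ ∑ i ∈ H, ((S *ᵥ x) i ^ 2 + 1) / 2 :=
      Finset.sum_le_sum fun i _ ↦ by nlinarith [sq_nonneg ((S *ᵥ x) i - 1)]
    _ = (∑ i ∈ H, (S *ᵥ x) i ^ 2 + H.card) / 2 := by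
      rw [← Finset.sum_div, Finset.sum_add_distrib]; simp
    _ ≤ H.card := by linarith

end SignMatrix

/-- The Koolen–Moulton estimate for a weighted sum of the entries of a `0`-`1` matrix `a`: here
`s` has at most unit row norms and average row sum at most `1`, and `d` is the average degree. -/
theorem two_mul_sum_mul_le {V : Type*} (H : Finset V) (s a : V → V → ℝ) {c d : ℝ} (hc : 0 < c)
    (hs : ∀ i ∈ H, ∑ j ∈ H, s i j ^ 2 ≤ 1) (hsum : ∑ i ∈ H, ∑ j ∈ H, s i j ≤ H.card)
    (ha : ∀ i j, a i j ^ 2 = a i j) (hd : ∑ i ∈ H, ∑ j ∈ H, a i j = H.card * d)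
    (hH : H.Nonempty) (hcd : c ≤ d) :
    2 * ∑ i ∈ H, ∑ j ∈ H, s i j * a i j ≤
      2 * d + (H.card * d - d ^ 2) / c + c * (H.card - 1) := by
  set n : ℝ := (H.card : ℝ) with hn
  have hn0 : 0 < n := by simpa [hn] using hH
  set t : ℝ := (∑ i ∈ H, ∑ j ∈ H, s i j) / n with ht
  have hst : ∑ i ∈ H, ∑ j ∈ H, s i j = n * t := by rw [ht]; field_simp
  have ht1 : t ≤ 1 := by rw [ht, div_le_one hn0]; exact hsum
  have hss : ∑ i ∈ H, ∑ j ∈ H, s i j ^ 2 ≤ n := by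
    simpa [hn] using Finset.sum_le_sum hs
  set E := ∑ i ∈ H, ∑ j ∈ H, s i j * a i j with hE
  have hexp : ∑ i ∈ H, ∑ j ∈ H, (c * s i j - a i j - (c * t - d) / n) ^ 2 =
      c ^ 2 * ∑ i ∈ H, ∑ j ∈ H, s i j ^ 2 + n * d - 2 * c * E - (c * t - d) ^ 2 := by
    have hpt : ∀ i j, (c * s i j - a i j - (c * t - d) / n) ^ 2 =
        c ^ 2 * s i j ^ 2 + a i j - 2 * c * (s i j * a i j)
          - 2 * ((c * t - d) / n) * c * s i j + 2 * ((c * t - d) / n) * a i j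
          + ((c * t - d) / n) ^ 2 := fun i j ↦ by
      linear_combination ha i j
    simp only [hpt, Finset.sum_add_distrib, Finset.sum_sub_distrib, ← Finset.mul_sum, hd, hst,
      Finset.sum_const, nsmul_eq_mul, ← hE, ← hn]
    field_simp
    ring
  have hpos : 0 ≤ ∑ i ∈ H, ∑ j ∈ H, (c * s i j - a i j - (c * t - d) / n) ^ 2 :=
    Finset.sum_nonneg fun i _ ↦ Finset.sum_nonneg fun j _ ↦ sq_nonneg _
  rw [hexp] at hpos
  have hkey : c * (2 * E) ≤ c * (2 * d + (n * d - d ^ 2) / c + c * (n - 1)) := by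
    have h1 : c * (2 * d + (n * d - d ^ 2) / c + c * (n - 1)) =
        2 * c * d + (n * d - d ^ 2) + c ^ 2 * (n - 1) := by
      field_simp
    rw [h1]
    nlinarith [mul_le_mul_of_nonneg_left hss (sq_nonneg c),
      mul_nonneg hc.le (mul_nonneg (sub_nonneg.2 ht1) (sub_nonneg.2 hcd)),
      mul_nonneg (sq_nonneg c) (sq_nonneg (1 - t))]
  exact le_of_mul_le_mul_left hkey hc

theorem koolenMoulton_le {n : ℕ} {c d : ℝ} (hn : 3 ≤ n) (hodd : Odd n) (hc : 0 < c)
    (hc6 : 6 ≤ c ^ 2) (hdc : d ≤ c ^ 2) (hdn : d ≤ n - 1) (hcd : c ≤ d) :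
    2 * d + (n * d - d ^ 2) / c + c * (n - 1) ≤ 2 * ((n - 1) * c) := by
  have hc2 : 2.44 ≤ c := by nlinarith
  have hkey : 0 ≤ n * (c ^ 2 - d) + (d - c) ^ 2 - 2 * c ^ 2 := by
    obtain h3 | h3 | h3 : n = 3 ∨ n = 5 ∨ 7 ≤ n := by
      obtain ⟨k, rfl⟩ := hodd
      omega
    · subst h3
      norm_num at hdn ⊢
      nlinarith
    · subst h3
      norm_num at hdn ⊢
      nlinarith [mul_nonneg (sub_nonneg.2 hdn) (sub_nonneg.2 hcd)]
    · have h7 : (7 : ℝ) ≤ n := by exact_mod_cast h3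
      nlinarith [mul_nonneg (sub_nonneg.2 h7) (sub_nonneg.2 hdc), sq_nonneg (2 * d - (7 + 2 * c))]
  rw [← sub_nonneg]
  have : 2 * ((n - 1) * c) - (2 * d + (n * d - d ^ 2) / c + c * (n - 1)) =
      (n * (c ^ 2 - d) + (d - c) ^ 2 - 2 * c ^ 2) / c := by
    field_simp
    ring
  rw [this]
  positivity

theorem card_mul_le_of_lt {n : ℕ} {c d : ℝ} (hn : 3 ≤ n) (hc : 0 < c)
    (hc6 : 6 ≤ c ^ 2) (hdn : d ≤ n - 1) (hcd : d < c) : n * d ≤ (n - 2) * c ^ 2 := by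
  have hc2 : 2 ≤ c := by nlinarith
  obtain rfl | h4 := hn.eq_or_lt
  · norm_num at hdn ⊢
    nlinarith
  · have h4 : (4 : ℝ) ≤ n := by exact_mod_cast h4
    nlinarith [mul_nonneg (sub_nonneg.2 h4) hc.le, mul_nonneg (sub_nonneg.2 hc2) hc.le,
      mul_nonneg (sub_nonneg.2 h4) (mul_nonneg (sub_nonneg.2 hc2) hc.le)]

theorem sum_mul_le_of_sum_sq_le {V : Type*} (T : Finset V) (x y : V → ℝ) {c : ℝ} (hc : 0 < c)
    (hx : ∑ j ∈ T, x j ^ 2 ≤ 1) (hy : ∀ j, y j ^ 2 = y j) :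
    2 * ∑ j ∈ T, x j * y j ≤ c + (∑ j ∈ T, y j) / c := by
  have hpt : ∀ j, 2 * (x j * y j) ≤ c * x j ^ 2 + y j / c := fun j ↦ by
    have h : c * x j ^ 2 + y j / c - 2 * (x j * y j) = (c * x j - y j) ^ 2 / c := by
      field_simp
      linear_combination -hy j
    have : 0 ≤ (c * x j - y j) ^ 2 / c := by positivity
    linarith
  calc 2 * ∑ j ∈ T, x j * y j ≤ ∑ j ∈ T, (c * x j ^ 2 + y j / c) := by
        rw [Finset.mul_sum]
        exact Finset.sum_le_sum fun j _ ↦ hpt j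
    _ = c * ∑ j ∈ T, x j ^ 2 + (∑ j ∈ T, y j) / c := by
        rw [Finset.sum_add_distrib, ← Finset.mul_sum, ← Finset.sum_div]
    _ ≤ c + (∑ j ∈ T, y j) / c := by nlinarith

theorem sum_mul_le_of_sum_le_sq {V : Type*} (T : Finset V) (x y : V → ℝ) {c : ℝ} (hc : 0 < c)
    (hx : ∑ j ∈ T, x j ^ 2 ≤ 1) (hy : ∀ j, y j ^ 2 = y j) (hyc : ∑ j ∈ T, y j ≤ c ^ 2) :
    ∑ j ∈ T, x j * y j ≤ c := by
  have h := sum_mul_le_of_sum_sq_le T x y hc hx hy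
  have h' : (∑ j ∈ T, y j) / c ≤ c := by rwa [div_le_iff₀ hc, ← sq]
  linarith

theorem sum_sum_mul_le_two_mul_card_div_two {V : Type*} [DecidableEq V] (H : Finset V)
    (s a : V → V → ℝ) {c : ℝ} (hc : 0 < c) (hc6 : 6 ≤ c ^ 2)
    (hs : ∀ i ∈ H, ∑ j ∈ H, s i j ^ 2 ≤ 1) (hsum : ∑ i ∈ H, ∑ j ∈ H, s i j ≤ H.card)
    (ha : ∀ i j, a i j ^ 2 = a i j) (hdiag : ∀ i, a i i = 0)
    (hrow : ∀ i ∈ H, ∑ j ∈ H, a i j ≤ c ^ 2) :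
    ∑ i ∈ H, ∑ j ∈ H, s i j * a i j ≤ 2 * (H.card / 2 : ℕ) * c := by
  rcases Nat.even_or_odd H.card with heven | hodd
  · have h : ∑ i ∈ H, ∑ j ∈ H, s i j * a i j ≤ H.card * c := by
      rw [← nsmul_eq_mul]
      exact Finset.sum_le_card_nsmul _ _ _ fun i hi ↦
        sum_mul_le_of_sum_le_sq H _ _ hc (hs i hi) (ha i) (hrow i hi)
    obtain ⟨k, hk⟩ := heven
    rw [hk, show (k + k) / 2 = k by omega]
    rw [hk] at h
    push_cast at h
    linarith
  have hdiv : (2 * (H.card / 2 : ℕ) : ℝ) = H.card - 1 := by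
    obtain ⟨k, hk⟩ := hodd
    rw [hk, show (2 * k + 1) / 2 = k by omega]
    push_cast
    ring
  rw [hdiv]
  by_cases hone : H.card = 1
  · obtain ⟨v, rfl⟩ := Finset.card_eq_one.1 hone
    simp [hdiag]
  have hn : 3 ≤ H.card := by
    obtain ⟨k, hk⟩ := hodd
    omega
  have hn0 : (0 : ℝ) < H.card := by
    exact_mod_cast (by omega : 0 < H.card)
  set d : ℝ := (∑ i ∈ H, ∑ j ∈ H, a i j) / H.card with hd
  have hm : ∑ i ∈ H, ∑ j ∈ H, a i j = H.card * d := by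
    rw [hd]
    field_simp
  have hdc : d ≤ c ^ 2 := by
    rw [hd, div_le_iff₀ hn0, mul_comm, ← nsmul_eq_mul]
    exact Finset.sum_le_card_nsmul _ _ _ hrow
  have hdn : d ≤ H.card - 1 := by
    rw [hd, div_le_iff₀ hn0, mul_comm, ← nsmul_eq_mul]
    refine Finset.sum_le_card_nsmul _ _ _ fun i hi ↦ ?_
    have h : ∑ j ∈ H.erase i, a i j ≤ (H.erase i).card • (1 : ℝ) :=
      Finset.sum_le_card_nsmul _ _ _ fun j _ ↦ by nlinarith [ha i j, sq_nonneg (a i j - 1)]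
    rw [Finset.card_erase_of_mem hi, nsmul_one, Nat.cast_sub (by omega), Nat.cast_one] at h
    rw [← Finset.add_sum_erase H _ hi, hdiag, zero_add]
    exact h
  suffices 2 * ∑ i ∈ H, ∑ j ∈ H, s i j * a i j ≤ 2 * ((H.card - 1) * c) by linarith
  rcases lt_or_ge d c with hcd | hcd
  · have h : 2 * ∑ i ∈ H, ∑ j ∈ H, s i j * a i j ≤ H.card * c + H.card * d / c := by
      rw [← hm, Finset.mul_sum, Finset.sum_div, ← nsmul_eq_mul, ← Finset.sum_const,
        ← Finset.sum_add_distrib]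
      exact Finset.sum_le_sum fun i hi ↦ sum_mul_le_of_sum_sq_le H _ _ hc (hs i hi) (ha i)
    have h' : H.card * d / c ≤ (H.card - 2) * c := by
      rw [div_le_iff₀ hc, mul_assoc, ← sq]
      exact card_mul_le_of_lt hn hc hc6 hdn hcd
    linarith
  · exact (two_mul_sum_mul_le H s a hc hs hsum ha hm (Finset.card_pos.1 (by omega)) hcd).trans
      (koolenMoulton_le hn hodd hc hc6 hdc hdn hcd)

theorem Finset.sum_sum_eq_sum_fiberwise {V : Type*} [Fintype V] [DecidableEq V] (B : Finset V)
    (c : V → V) (F : V → V → ℝ) (hF : ∀ i ∈ B, ∀ j ∈ B, c i ≠ c j → F i j = 0) :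
    ∑ i ∈ B, ∑ j ∈ B, F i j = ∑ l, ∑ i ∈ B with c i = l, ∑ j ∈ B with c j = l, F i j := by
  rw [← Finset.sum_fiberwise B c]
  refine Finset.sum_congr rfl fun l _ ↦ Finset.sum_congr rfl fun i hi ↦ ?_
  rw [Finset.mem_filter] at hi
  refine (Finset.sum_subset (Finset.filter_subset _ _) fun j hj hjl ↦ hF i hi.1 j hj ?_).symm
  rintro h
  exact hjl (Finset.mem_filter.2 ⟨hj, h.symm.trans hi.2⟩)

/-- Every connected simple graph `G` with `Δ(G) ≥ 6` satisfies
`E(G) ≤ 2 ν(G) √(Δ(G))`. -/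
theorem energy_le_two_mul_matchingNumber_mul_sqrt_maxDeg
    {V : Type*} [Fintype V] [DecidableEq V] (G : SimpleGraph V)
    (hconn : G.Connected) (hdeg : 6 ≤ maxDeg G) :
    graphEnergy G ≤ 2 * (matchingNumber G : ℝ) * Real.sqrt (maxDeg G) := by
  let : DecidableRel G.Adj := Classical.decRel _
  obtain ⟨f, hf, A, -, c, hadj, hle⟩ := exists_barrier G Finset.univ
  obtain ⟨S, hS, hSS, hE⟩ := (adjMatrix_isHermitian G).exists_sign
  set r : ℝ := √(maxDeg G) with hr
  have hr2 : r ^ 2 = maxDeg G := Real.sq_sqrt (Nat.cast_nonneg _)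
  have hr6 : 6 ≤ r ^ 2 := by rw [hr2]; exact_mod_cast hdeg
  have hr0 : 0 < r := (Real.sqrt_nonneg _).lt_of_ne fun h ↦ by
    rw [← hr] at h
    norm_num [← h] at hr6
  let a : V → V → ℝ := fun i j ↦ G.adjMatrix ℝ i j
  have ha : ∀ i j, a i j ^ 2 = a i j := fun i j ↦ by simp [a, adjMatrix_apply]
  have ha0 : ∀ i j, 0 ≤ a i j := fun i j ↦ ha i j ▸ sq_nonneg _
  have hsymm : ∀ i j, S i j * a i j = S j i * a j i := fun i j ↦ by
    simp only [a]
    rw [hS.apply, (G.isSymm_adjMatrix (α := ℝ)).apply]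
  have hrow : ∀ i, ∀ T : Finset V, ∑ j ∈ T, a i j ≤ r ^ 2 := fun i T ↦
    calc ∑ j ∈ T, a i j ≤ ∑ j, a i j :=
          Finset.sum_le_sum_of_subset_of_nonneg (Finset.subset_univ _) fun j _ _ ↦ ha0 i j
      _ = G.degree i := by simp [a, adjMatrix_apply, ← G.card_neighborFinset_eq_degree,
          neighborFinset_eq_filter]
      _ ≤ r ^ 2 := by
          rw [hr2]
          exact_mod_cast G.degree_le_maxDegree i
  have hSrow : ∀ i, ∀ T : Finset V, ∑ j ∈ T, S i j ^ 2 ≤ 1 := fun i T ↦ by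
    rw [← hS.sum_sq_row_eq_one hSS i]
    exact Finset.sum_le_sum_of_subset_of_nonneg (Finset.subset_univ _) fun j _ _ ↦ sq_nonneg _
  have hstar : ∀ T : Finset V, ∑ i ∈ A, ∑ j ∈ T, S i j * a i j ≤ A.card * r := fun T ↦ by
    rw [← nsmul_eq_mul]
    exact Finset.sum_le_card_nsmul _ _ _ fun i _ ↦
      sum_mul_le_of_sum_le_sq T _ _ hr0 (hSrow i T) (ha i) (hrow i T)
  have htrace : graphEnergy G = ∑ i, ∑ j, S i j * a i j := by
    rw [graphEnergy, hE, Matrix.trace]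
    refine Finset.sum_congr rfl fun i _ ↦ ?_
    rw [Matrix.diag_apply, Matrix.mul_apply]
    exact Finset.sum_congr rfl fun j _ ↦ by rw [(G.isSymm_adjMatrix (α := ℝ)).apply]
  have hsplit : ∑ i, ∑ j, S i j * a i j = ∑ i ∈ A, ∑ j, S i j * a i j +
      ∑ i ∈ A, ∑ j ∈ Finset.univ \ A, S i j * a i j +
      ∑ i ∈ Finset.univ \ A, ∑ j ∈ Finset.univ \ A, S i j * a i j := by
    rw [← Finset.sum_sdiff (Finset.subset_univ A)]
    simp_rw [fun i ↦ (Finset.sum_sdiff (f := fun j ↦ S i j * a i j) (Finset.subset_univ A)).symm]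
    simp only [Finset.sum_add_distrib]
    rw [Finset.sum_comm (s := Finset.univ \ A) (t := A)]
    simp_rw [fun i j ↦ hsymm j i]
    ring
  have hclasses : ∑ i ∈ Finset.univ \ A, ∑ j ∈ Finset.univ \ A, S i j * a i j ≤
      ∑ l, 2 * ((({w ∈ Finset.univ \ A | c w = l} : Finset V).card / 2 : ℕ) : ℝ) * r := by
    rw [Finset.sum_sum_eq_sum_fiberwise _ c]
    · exact Finset.sum_le_sum fun l _ ↦ sum_sum_mul_le_two_mul_card_div_two _ S a hr0 hr6
        (fun i _ ↦ hSrow i _) (hS.sum_sum_le_card hSS _) ha (fun i ↦ by simp [a])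
        fun i _ ↦ hrow i _
    · intro i hi j hj hij
      have : ¬ G.Adj i j := fun h ↦ hij (hadj i hi j hj h)
      simp [a, adjMatrix_apply, this]
  have hbound : (2 * A.card + ∑ l, 2 * ((({w ∈ Finset.univ \ A | c w = l} : Finset V).card / 2 : ℕ)
      : ℝ)) ≤ 2 * matchingNumber G := by
    exact_mod_cast hle.trans hf.card_le_two_mul_matchingNumber
  calc graphEnergy G ≤ A.card * r + A.card * r +
        ∑ l, 2 * ((({w ∈ Finset.univ \ A | c w = l} : Finset V).card / 2 : ℕ) : ℝ) * r := by
        rw [htrace, hsplit]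
        exact add_le_add (add_le_add (hstar _) (hstar _)) hclasses
    _ = (2 * A.card + ∑ l, 2 * ((({w ∈ Finset.univ \ A | c w = l} : Finset V).card / 2 : ℕ)
          : ℝ)) * r := by
        rw [← Finset.sum_mul]
        ring
    _ ≤ 2 * matchingNumber G * r := mul_le_mul_of_nonneg_right hbound hr0.le
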